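/- Let T > 0 and let A : ℝ → ℝ^{n×n} be continuous with A(t + T) = A(t) for all t. Suppose the linear system ẋ = A(t)x is exponentially stable: there exist c > 0 and λ > 0 such that every differentiable x : ℝ → ℝⁿ with x'(t) = A(t)x(t) for all t satisfies ‖x(t)‖ ≤ c·e^{−λ(t−s)}·‖x(s)‖ for all t ≥ s. Then for every symmetric positive definite matrix Q ∈ ℝ^{n×n} there exists a unique differentiable T-periodic matrix function P : ℝ → ℝ^{n×n} satisfying the Lyapunov differential equation P'(t) + A(t)ᵀP(t) + P(t)A(t) + Q = 0 for all t; moreover this P(t) is symmetric and positive definite for every t. -/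

import Mathlib

open Matrix

theorem lyap_int_bound {E : Type*} [NormedAddCommGroup E] [NormedSpace ℝ E]
    (g : ℝ → E) (B K : ℝ) (hB : 0 ≤ B) (hK : 0 < K)
    (hb : ∀ s, ‖g s‖ ≤ B * Real.cosh (K * s)) (t : ℝ) :
    ‖∫ s in (0:ℝ)..t, g s‖ ≤ B / K * Real.cosh (K * t) := by
  have hd : ∀ s : ℝ, HasDerivAt (fun s => B / K * Real.sinh (K * s)) (B * Real.cosh (K * s)) s := by
    intro s
    have h1 : HasDerivAt (fun s : ℝ => K * s) K s := by
      simpa using (hasDerivAt_id s).const_mul K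
    have := (h1.sinh).const_mul (B / K)
    have h2 : B / K * (Real.cosh (K * s) * K) = B * Real.cosh (K * s) := by field_simp
    rwa [h2] at this
  have hc : Continuous fun s : ℝ => B * Real.cosh (K * s) := by fun_prop
  have h1 : ‖∫ s in (0:ℝ)..t, g s‖ ≤ |∫ s in (0:ℝ)..t, B * Real.cosh (K * s)| :=
    intervalIntegral.norm_integral_le_abs_of_norm_le (Filter.Eventually.of_forall fun s => hb s)
      (hc.intervalIntegrable _ _)
  rw [intervalIntegral.integral_eq_sub_of_hasDerivAt (fun s _ => hd s)
    (hc.intervalIntegrable _ _)] at h1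
  refine h1.trans ?_
  have h0 : 0 ≤ B / K := by positivity
  simp only [mul_zero, Real.sinh_zero, sub_zero, abs_mul, abs_of_nonneg h0]
  gcongr
  rw [abs_le]
  have := Real.sinh_lt_cosh (K * t)
  have h2 := Real.sinh_lt_cosh (-(K * t))
  rw [Real.sinh_neg, Real.cosh_neg] at h2
  constructor <;> linarith

open scoped BoundedContinuousFunction in
theorem lyap_exists {E : Type*} [NormedAddCommGroup E] [NormedSpace ℝ E] [CompleteSpace E]
    (L : ℝ → E →L[ℝ] E) (hL : Continuous L) (M : ℝ) (hM : 0 < M) (hLM : ∀ t, ‖L t‖ ≤ M) (x0 : E) :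
    ∃ x : ℝ → E, x 0 = x0 ∧ ∀ t, HasDerivAt x (L t (x t)) t := by
  have hK : 0 < 2 * M := by positivity
  have hcosh : ∀ t : ℝ, 0 < Real.cosh (2 * M * t) := fun t => Real.cosh_pos _
  have hcont : ∀ y : ℝ →ᵇ E, Continuous fun s => Real.cosh (2 * M * s) • L s (y s) := by
    intro y
    exact (by fun_prop : Continuous fun s : ℝ => Real.cosh (2 * M * s)).smul
      (hL.clm_apply y.continuous)
  have hbd : ∀ (y : ℝ →ᵇ E) s, ‖Real.cosh (2 * M * s) • L s (y s)‖
      ≤ (M * ‖y‖) * Real.cosh (2 * M * s) := by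
    intro y s
    rw [norm_smul, Real.norm_of_nonneg (hcosh s).le, mul_comm]
    have : ‖L s (y s)‖ ≤ M * ‖y‖ :=
      (L s).le_of_opNorm_le_of_le (hLM s) (y.norm_coe_le_norm s)
    gcongr
  let F : (ℝ →ᵇ E) → (ℝ →ᵇ E) := fun y =>
    BoundedContinuousFunction.ofNormedAddCommGroup
      (fun t => (Real.cosh (2 * M * t))⁻¹ •
        (x0 + ∫ s in (0:ℝ)..t, Real.cosh (2 * M * s) • L s (y s)))
      (by
        refine Continuous.smul ?_ ?_
        · exact Continuous.inv₀ (by fun_prop) fun t => (hcosh t).ne'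
        · exact continuous_const.add
            (intervalIntegral.continuous_primitive (fun a b => (hcont y).intervalIntegrable a b) 0))
      (‖x0‖ + ‖y‖ / 2)
      (by
        intro t
        rw [norm_smul, norm_inv, Real.norm_of_nonneg (hcosh t).le, inv_mul_le_iff₀ (hcosh t)]
        have h1 := lyap_int_bound _ (M * ‖y‖) (2 * M) (by positivity) hK (hbd y) t
        have h2 : M * ‖y‖ / (2 * M) = ‖y‖ / 2 := by field_simp
        rw [h2] at h1
        refine (norm_add_le _ _).trans ?_
        have h3 := Real.one_le_cosh (2 * M * t)
        nlinarith [norm_nonneg x0])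
  have hF : ContractingWith (1/2) F := by
    refine ⟨by rw [← NNReal.coe_lt_coe]; norm_num, LipschitzWith.of_dist_le_mul fun y z => ?_⟩
    rw [BoundedContinuousFunction.dist_le (by positivity)]
    intro t
    have h1 := lyap_int_bound _ (M * ‖y - z‖) (2 * M) (by positivity) hK (hbd (y - z)) t
    have h2 : M * ‖y - z‖ / (2 * M) = ‖y - z‖ / 2 := by field_simp
    rw [h2] at h1
    have h4 : F y t - F z t = (Real.cosh (2 * M * t))⁻¹ •
        ∫ s in (0:ℝ)..t, Real.cosh (2 * M * s) • L s ((y - z) s) := by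
      simp only [F, BoundedContinuousFunction.coe_ofNormedAddCommGroup, ← smul_sub,
        add_sub_add_left_eq_sub]
      rw [← intervalIntegral.integral_sub ((hcont y).intervalIntegrable _ _)
        ((hcont z).intervalIntegrable _ _)]
      simp only [BoundedContinuousFunction.coe_sub, Pi.sub_apply, map_sub, smul_sub]
    rw [dist_eq_norm, h4, norm_smul, norm_inv, Real.norm_of_nonneg (hcosh t).le,
      inv_mul_le_iff₀ (hcosh t), dist_eq_norm]
    refine h1.trans (le_of_eq ?_)
    push_cast
    ring
  obtain ⟨y, hy⟩ : ∃ y, F y = y := ⟨hF.fixedPoint F, hF.fixedPoint_isFixedPt⟩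
  have hy' : ∀ t, Real.cosh (2 * M * t) • y t
      = x0 + ∫ s in (0:ℝ)..t, Real.cosh (2 * M * s) • L s (y s) := by
    intro t
    conv_lhs => rw [← hy]
    simp only [F, BoundedContinuousFunction.coe_ofNormedAddCommGroup]
    rw [smul_inv_smul₀ (hcosh t).ne']
  refine ⟨fun t => Real.cosh (2 * M * t) • y t, by simpa using hy' 0, fun t => ?_⟩
  simp only [map_smul]
  rw [funext hy']
  exact ((hcont y).integral_hasStrictDerivAt 0 t).hasDerivAt.const_add x0

theorem lyap_const {E : Type*} [NormedAddCommGroup E] [NormedSpace ℝ E] (f : ℝ → E)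
    (h : ∀ t, HasDerivAt f 0 t) (s t : ℝ) : f s = f t :=
  is_const_of_deriv_eq_zero (fun t => (h t).differentiableAt) (fun t => (h t).deriv) s t


theorem lyap_abstract {R : Type*} [NormedRing R] [NormedAlgebra ℝ R] [CompleteSpace R]
    (hDF : ∀ a b : R, a * b = 1 → b * a = 1)
    (τ : R →L[ℝ] R) (hmul : ∀ a b, τ (a * b) = τ b * τ a) (hinv : ∀ a, τ (τ a) = a)
    (hone : τ 1 = 1)
    (T : ℝ) (hT : 0 < T) (A : ℝ → R)
    (hAcont : Continuous A) (hAper : ∀ t : ℝ, A (t + T) = A t)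
    (c lam : ℝ) (hc : 0 < c) (hlam : 0 < lam)
    (hdec : ∀ Φ : ℝ → R, Φ 0 = 1 → (∀ t, HasDerivAt Φ (A t * Φ t) t) →
      ∀ t, 0 ≤ t → ‖Φ t‖ ≤ c * Real.exp (-lam * t))
    (Q : R) (hQsymm : τ Q = Q) :
    ∃ P J Φ Ψ : ℝ → R, (∀ t, HasDerivAt P (-(τ (A t) * P t) - P t * A t - Q) t) ∧
      (∀ t, P (t + T) = P t) ∧ (∀ t, τ (P t) = P t) ∧
      (∀ t, Ψ t * Φ t = 1) ∧ (∀ t, Φ t * Ψ t = 1) ∧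
      (∀ t, P t = τ (Ψ t) * J t * Ψ t) ∧
      (∀ t, HasDerivAt J (-(τ (Φ t) * Q * Φ t)) t) ∧
      Filter.Tendsto J Filter.atTop (nhds 0) ∧
      ∀ P₂ : ℝ → R, (∀ t, HasDerivAt P₂ (-(τ (A t) * P₂ t) - P₂ t * A t - Q) t) →
        (∀ t, P₂ (t + T) = P₂ t) → P₂ = P := by
  have htd : ∀ {M : ℝ → R} {M' : R} {t : ℝ}, HasDerivAt M M' t →
      HasDerivAt (fun s => τ (M s)) (τ M') t := fun {M M' t} h =>
    (τ.hasFDerivAt (x := M t)).comp_hasDerivAt t h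
  have htt : ∀ {M : ℝ → R}, Filter.Tendsto M Filter.atTop (nhds 0) →
      Filter.Tendsto (fun s => τ (M s)) Filter.atTop (nhds 0) := fun {M} h => by
    have := (τ.continuous.tendsto 0).comp h
    rw [map_zero] at this
    exact this
  -- bound on `A`
  obtain ⟨M, hM, hAM⟩ : ∃ M : ℝ, 0 < M ∧ ∀ t, ‖A t‖ ≤ M := by
    have hb := Function.Periodic.isBounded_of_continuous (f := A) (c := T) hAper hT.ne' hAcont
    obtain ⟨M, hM, h⟩ := hb.exists_pos_norm_le
    exact ⟨M, hM, fun t => h _ ⟨t, rfl⟩⟩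
  -- fundamental matrix and its inverse
  obtain ⟨Φ, hΦ0, hΦ⟩ := lyap_exists
    (fun t => ContinuousLinearMap.mul ℝ (R) (A t))
    ((ContinuousLinearMap.mul ℝ (R)).continuous.comp hAcont) M hM
    (fun t => (ContinuousLinearMap.opNorm_mul_apply_le ℝ _ (A t)).trans (hAM t)) 1
  obtain ⟨Ψ, hΨ0, hΨ⟩ := lyap_exists
    (fun t => -(ContinuousLinearMap.mul ℝ (R)).flip (A t))
    ((ContinuousLinearMap.mul ℝ (R)).flip.continuous.comp hAcont).neg M hM
    (fun t => by
      rw [norm_neg]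
      refine ContinuousLinearMap.opNorm_le_bound _ hM.le fun X => ?_
      rw [ContinuousLinearMap.flip_apply, ContinuousLinearMap.mul_apply', mul_comm M]
      exact (norm_mul_le _ _).trans (by gcongr; exact hAM t)) 1
  replace hΦ : ∀ t, HasDerivAt Φ (A t * Φ t) t := hΦ
  replace hΨ : ∀ t, HasDerivAt Ψ (-(Ψ t * A t)) t := hΨ
  have hΨΦ : ∀ t, Ψ t * Φ t = 1 := by
    intro t
    have h := lyap_const (fun t => Ψ t * Φ t) (fun t => by
      have := (hΨ t).mul (hΦ t)
      refine this.congr_deriv ?_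
      noncomm_ring) t 0
    simpa [hΦ0, hΨ0] using h
  have hΦΨ : ∀ t, Φ t * Ψ t = 1 := fun t => hDF _ _ (hΨΦ t)
  have hΨΦT : ∀ t, τ (Φ t) * τ (Ψ t) = 1 := fun t => by
    rw [← hmul, hΨΦ, hone]
  have hΦΨT : ∀ t, τ (Ψ t) * τ (Φ t) = 1 := fun t => by
    rw [← hmul, hΦΨ, hone]
  -- Floquet
  have hFl : ∀ t, Φ (t + T) = Φ t * Φ T := by
    intro t
    have h := lyap_const (fun t => Ψ t * Φ (t + T)) (fun t => by
      have := (hΨ t).mul ((hΦ (t + T)).comp_add_const t T)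
      refine this.congr_deriv ?_
      rw [hAper]
      noncomm_ring) t 0
    simp only [hΨ0, zero_add, one_mul] at h
    rw [← h, ← mul_assoc, hΦΨ, one_mul]
  have hFl' : ∀ t, Φ t = Φ (t + T) * Ψ T := by
    intro t
    rw [hFl, mul_assoc, hΦΨ, mul_one]
  -- decay
  have hdecay := hdec Φ hΦ0 hΦ
  have hΦlim : Filter.Tendsto Φ Filter.atTop (nhds 0) := by
    refine squeeze_zero_norm' (a := fun t => c * Real.exp (-lam * t)) ?_ ?_
    · filter_upwards [Filter.eventually_ge_atTop 0] with t ht using hdecay t ht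
    · have h1 : Filter.Tendsto (fun t : ℝ => Real.exp (-(lam * t))) Filter.atTop (nhds 0) :=
        Real.tendsto_exp_neg_atTop_nhds_zero.comp (Filter.tendsto_id.const_mul_atTop hlam)
      simpa using h1.const_mul c
  have hΦTlim := htt hΦlim
  -- uniqueness principle
  have hU : ∀ D : ℝ → R,
      (∀ t, HasDerivAt D (-((τ (A t)) * D t) - D t * A t) t) →
      Filter.Tendsto (fun t => τ (Φ t) * D t * Φ t) Filter.atTop (nhds 0) → ∀ t, D t = 0 := by
    intro D hD hlim t
    have hcst := lyap_const (fun t => τ (Φ t) * D t * Φ t) (fun t => by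
      have := ((htd (hΦ t)).mul (hD t)).mul (hΦ t)
      refine this.congr_deriv ?_
      simp only [hmul, Pi.mul_apply]
      noncomm_ring)
    have h0 : τ (Φ t) * D t * Φ t = 0 := by
      have : (fun s => τ (Φ s) * D s * Φ s) = fun _ => τ (Φ t) * D t * Φ t :=
        funext fun s => hcst s t
      rw [this] at hlim
      exact tendsto_nhds_unique tendsto_const_nhds hlim
    calc D t = ((τ (Ψ t)) * τ (Φ t)) * D t * (Φ t * Ψ t) := by rw [hΦΨT, hΦΨ, one_mul, mul_one]
      _ = τ (Ψ t) * ((τ (Φ t)) * D t * Φ t) * Ψ t := by noncomm_ring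
      _ = 0 := by rw [h0, mul_zero, zero_mul]
  -- the integrand
  obtain ⟨G, hG⟩ : ∃ G : ℝ → R, G = fun s => τ (Φ s) * Q * Φ s := ⟨_, rfl⟩
  have hΦc : Continuous Φ := continuous_iff_continuousAt.mpr fun t => (hΦ t).continuousAt
  have hΦTc : Continuous fun t => τ (Φ t) :=
    continuous_iff_continuousAt.mpr fun t => (htd (hΦ t)).continuousAt
  have hGc : Continuous G := by
    rw [hG]; exact (hΦTc.mul continuous_const).mul hΦc
  have hk : ∀ X, ‖τ X‖ ≤ ‖τ‖ * ‖X‖ := τ.le_opNorm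
  have hGi : MeasureTheory.IntegrableOn G (Set.Ioi 0) := by
    have h1 := (exp_neg_integrableOn_Ioi 0 (by positivity : 0 < 2 * lam)).const_mul (‖τ‖ * c * ‖Q‖ * c)
    refine MeasureTheory.Integrable.mono' h1 hGc.aestronglyMeasurable ?_
    refine (MeasureTheory.ae_restrict_mem measurableSet_Ioi).mono fun t ht => ?_
    have hd := hdecay t (le_of_lt ht)
    have e : Real.exp (-(2 * lam) * t) = Real.exp (-lam * t) * Real.exp (-lam * t) := by
      rw [← Real.exp_add]; congr 1; ring
    rw [e, hG]
    calc ‖τ (Φ t) * Q * Φ t‖ ≤ ‖τ (Φ t) * Q‖ * ‖Φ t‖ := norm_mul_le _ _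
      _ ≤ (‖(τ (Φ t))‖ * ‖Q‖) * ‖Φ t‖ := by gcongr; exact norm_mul_le _ _
      _ ≤ ((‖τ‖ * (c * Real.exp (-lam * t))) * ‖Q‖) * (c * Real.exp (-lam * t)) := by
          gcongr
          exact (hk _).trans (by gcongr)
      _ = _ := by ring
  have hlimG := MeasureTheory.intervalIntegral_tendsto_integral_Ioi 0 hGi Filter.tendsto_id
  obtain ⟨J, hJ⟩ : ∃ J : ℝ → R,
      J = fun t => (∫ s in Set.Ioi (0:ℝ), G s) - ∫ s in (0:ℝ)..t, G s := ⟨_, rfl⟩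
  have hJd : ∀ t, HasDerivAt J (-G t) t := by
    intro t
    rw [hJ]
    exact (hGc.integral_hasStrictDerivAt 0 t).hasDerivAt.const_sub _
  have hJlim : Filter.Tendsto J Filter.atTop (nhds 0) := by
    rw [hJ]
    have := (tendsto_const_nhds (x := ∫ s in Set.Ioi (0:ℝ), G s)).sub hlimG
    rw [sub_self] at this
    exact this
  obtain ⟨P, hP⟩ : ∃ P : ℝ → R, P = fun t => τ (Ψ t) * J t * Ψ t := ⟨_, rfl⟩
  have hPJ : ∀ t, τ (Φ t) * P t * Φ t = J t := by
    intro t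
    rw [hP]
    beta_reduce
    calc τ (Φ t) * ((τ (Ψ t)) * J t * Ψ t) * Φ t = ((τ (Φ t)) * τ (Ψ t)) * J t * (Ψ t * Φ t) := by
          noncomm_ring
      _ = J t := by rw [hΨΦT, hΨΦ, one_mul, mul_one]
  have hPG : ∀ t, τ (Ψ t) * G t * Ψ t = Q := by
    intro t
    rw [hG]
    beta_reduce
    calc τ (Ψ t) * ((τ (Φ t)) * Q * Φ t) * Ψ t = ((τ (Ψ t)) * τ (Φ t)) * Q * (Φ t * Ψ t) := by
          noncomm_ring
      _ = Q := by rw [hΦΨT, hΦΨ, one_mul, mul_one]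
  have hPd : ∀ t, HasDerivAt P (-((τ (A t)) * P t) - P t * A t - Q) t := by
    intro t
    have := ((htd (hΨ t)).mul (hJd t)).mul (hΨ t)
    rw [← hPG t, hP]
    refine this.congr_deriv ?_
    simp only [hmul, map_neg, Pi.mul_apply]
    noncomm_ring
  have hPer : ∀ t, P (t + T) = P t := by
    intro t
    have := hU (fun t => P (t + T) - P t) (fun t => by
      have := ((hPd (t + T)).comp_add_const t T).sub (hPd t)
      refine this.congr_deriv ?_
      rw [hAper]
      noncomm_ring) (by
      have h1 : Filter.Tendsto (fun t => τ (Ψ T) * J (t + T) * Ψ T - J t) Filter.atTop (nhds 0) := by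
        have h2 := hJlim.comp (Filter.tendsto_atTop_add_const_right Filter.atTop T Filter.tendsto_id)
        have h3 := ((h2.const_mul (τ (Ψ T))).mul_const (Ψ T)).sub hJlim
        simpa using h3
      refine h1.congr fun t => ?_
      rw [mul_sub, sub_mul, hPJ, ← hPJ (t + T)]
      rw [hFl' t, hmul]
      noncomm_ring) t
    exact sub_eq_zero.mp this
  have hSymm : ∀ t, τ (P t) = P t := by
    intro t
    have := hU (fun t => τ (P t) - P t) (fun t => by
      have := (htd (hPd t)).sub (hPd t)
      refine this.congr_deriv ?_
      simp only [map_sub, map_neg, hmul,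
        hinv, hQsymm]
      noncomm_ring) (by
      have h1 := (htt hJlim).sub hJlim
      rw [sub_zero] at h1
      refine h1.congr fun t => ?_
      rw [mul_sub, sub_mul, hPJ]
      congr 1
      rw [← hPJ]
      simp only [hmul, hinv, mul_assoc]) t
    exact sub_eq_zero.mp this
  refine ⟨P, J, Φ, Ψ, hPd, hPer, hSymm, hΨΦ, hΦΨ, fun t => by rw [hP], fun t => ?_, hJlim, ?_⟩
  · have := hJd t
    rw [hG] at this
    exact this
  intro P₂ hd2 hper
  have hc2 : Continuous P₂ := continuous_iff_continuousAt.mpr fun t => (hd2 t).continuousAt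
  obtain ⟨B, hB, hPB⟩ : ∃ B : ℝ, 0 < B ∧ ∀ t, ‖P₂ t‖ ≤ B := by
    have hb := Function.Periodic.isBounded_of_continuous (f := P₂) (c := T) hper hT.ne' hc2
    obtain ⟨M, hM, h⟩ := hb.exists_pos_norm_le
    exact ⟨M, hM, fun t => h _ ⟨t, rfl⟩⟩
  have hlim2 : Filter.Tendsto (fun t => τ (Φ t) * P₂ t * Φ t) Filter.atTop (nhds 0) := by
    have h1 : Filter.Tendsto (fun t => ‖τ (Φ t)‖ * B * ‖Φ t‖) Filter.atTop (nhds 0) := by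
      simpa using (hΦTlim.norm.mul_const B).mul hΦlim.norm
    refine squeeze_zero_norm (fun t => ?_) h1
    refine (norm_mul_le _ _).trans ?_
    gcongr
    refine (norm_mul_le _ _).trans ?_
    gcongr
    exact hPB t
  funext t
  have := hU (fun t => P₂ t - P t) (fun t => by
    have := (hd2 t).sub (hPd t)
    refine this.congr_deriv ?_
    noncomm_ring) (by
    have h1 := hlim2.sub hJlim
    rw [sub_zero] at h1
    refine h1.congr fun t => ?_
    rw [mul_sub, sub_mul, hPJ]) t
  exact sub_eq_zero.mp this


section
attribute [local instance] Matrix.linftyOpNormedAddCommGroup Matrix.linftyOpNormedSpace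
  Matrix.linftyOpNormedRing Matrix.linftyOpNormedAlgebra

theorem lyap_hasDerivAt_iff {n : ℕ}
    (M : ℝ → Matrix (Fin n) (Fin n) ℝ) (M' : Matrix (Fin n) (Fin n) ℝ) (t : ℝ) :
    HasDerivAt M M' t ↔ ∀ i j, HasDerivAt (fun s => M s i j) (M' i j) t := by
  constructor
  · intro h i j
    exact ((Matrix.entryLinearMap ℝ ℝ i j).toContinuousLinearMap.hasFDerivAt
      (x := M t)).comp_hasDerivAt t h
  · intro h
    have e : M = fun s => ∑ i, ∑ j, Matrix.single i j (M s i j) := by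
      funext s; exact Matrix.matrix_eq_sum_single _
    rw [e, Matrix.matrix_eq_sum_single M']
    refine HasDerivAt.fun_sum fun i _ => HasDerivAt.fun_sum fun j _ => ?_
    exact ((Matrix.singleLinearMap ℝ i j).toContinuousLinearMap.hasFDerivAt
      (x := M t i j)).comp_hasDerivAt t (h i j)

theorem lyap_hasDerivAt_mulVec {n : ℕ}
    {M : ℝ → Matrix (Fin n) (Fin n) ℝ} {M' : Matrix (Fin n) (Fin n) ℝ} {t : ℝ}
    (v : Fin n → ℝ) (h : HasDerivAt M M' t) : HasDerivAt (fun s => M s *ᵥ v) (M' *ᵥ v) t :=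
  (((Matrix.mulVecBilin ℝ ℝ).flip v).toContinuousLinearMap.hasFDerivAt
    (x := M t)).comp_hasDerivAt t h

/-- the linear functional `M ↦ vᵀ M v` -/
noncomputable def lyapQuad {n : ℕ} (v : Fin n → ℝ) : Matrix (Fin n) (Fin n) ℝ →L[ℝ] ℝ :=
  LinearMap.toContinuousLinearMap
    { toFun := fun M => v ⬝ᵥ M *ᵥ v
      map_add' := by intro M N; simp [Matrix.add_mulVec, dotProduct_add]
      map_smul' := by intro a M; simp [Matrix.smul_mulVec, dotProduct_smul] }

theorem lyapQuad_apply {n : ℕ} (v : Fin n → ℝ) (M : Matrix (Fin n) (Fin n) ℝ) :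
    lyapQuad v M = v ⬝ᵥ M *ᵥ v := rfl

theorem lyap_quad_conj {n : ℕ} (v : Fin n → ℝ) (M B : Matrix (Fin n) (Fin n) ℝ) :
    v ⬝ᵥ (Bᵀ * M * B) *ᵥ v = (B *ᵥ v) ⬝ᵥ M *ᵥ (B *ᵥ v) := by
  rw [← Matrix.mulVec_mulVec, ← Matrix.mulVec_mulVec, Matrix.dotProduct_mulVec,
    Matrix.vecMul_transpose]

theorem lyap_core
    {n : ℕ} (T : ℝ) (hT : 0 < T)
    (A : ℝ → Matrix (Fin n) (Fin n) ℝ)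
    (hAcont : Continuous A) (hAper : ∀ t : ℝ, A (t + T) = A t)
    (c lam : ℝ) (hc : 0 < c) (hlam : 0 < lam)
    (hstab : ∀ x : ℝ → (Fin n → ℝ), Differentiable ℝ x →
      (∀ t : ℝ, deriv x t = (A t).mulVec (x t)) →
      ∀ s t : ℝ, s ≤ t → ‖x t‖ ≤ c * Real.exp (-lam * (t - s)) * ‖x s‖)
    (Q : Matrix (Fin n) (Fin n) ℝ) (hQsymm : Q.IsSymm) (hQpos : Q.PosDef) :
    ∃ P : ℝ → Matrix (Fin n) (Fin n) ℝ,
      ((∀ (t : ℝ) (i j : Fin n), DifferentiableAt ℝ (fun s => P s i j) t) ∧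
        (∀ t : ℝ, Matrix.of (fun i j => deriv (fun s => P s i j) t)
          + (A t)ᵀ * P t + P t * A t + Q = 0) ∧
        (∀ t : ℝ, P (t + T) = P t)) ∧
      (∀ t : ℝ, (P t).IsSymm ∧ (P t).PosDef) ∧
      (∀ P₂ : ℝ → Matrix (Fin n) (Fin n) ℝ,
        ((∀ (t : ℝ) (i j : Fin n), DifferentiableAt ℝ (fun s => P₂ s i j) t) ∧
          (∀ t : ℝ, Matrix.of (fun i j => deriv (fun s => P₂ s i j) t)
            + (A t)ᵀ * P₂ t + P₂ t * A t + Q = 0) ∧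
          (∀ t : ℝ, P₂ (t + T) = P₂ t)) → P₂ = P) := by
  obtain ⟨P, J, Φ, Ψ, hPd, hPer, hSymm, hΨΦ, hΦΨ, hP, hJd, hJlim, huniq⟩ := lyap_abstract
    (R := Matrix (Fin n) (Fin n) ℝ) (fun a b h => mul_eq_one_comm.mp h)
    (Matrix.transposeLinearEquiv (Fin n) (Fin n) ℝ ℝ).toLinearMap.toContinuousLinearMap
    (fun a b => Matrix.transpose_mul a b) (fun a => Matrix.transpose_transpose a)
    Matrix.transpose_one T hT A hAcont hAper c lam hc hlam (by
      intro Φ hΦ0 hΦ t ht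
      rw [Matrix.linfty_opNorm_eq_opNorm]
      refine ContinuousLinearMap.opNorm_le_bound _ (by positivity) fun v => ?_
      have hx : ∀ t, HasDerivAt (fun s => Φ s *ᵥ v) (A t *ᵥ (Φ t *ᵥ v)) t := by
        intro t
        have := lyap_hasDerivAt_mulVec v (hΦ t)
        rwa [← Matrix.mulVec_mulVec] at this
      have := hstab (fun s => Φ s *ᵥ v) (fun t => (hx t).differentiableAt)
        (fun t => (hx t).deriv) 0 t ht
      simpa [hΦ0] using this) Q hQsymm
  replace hPd : ∀ t, HasDerivAt P (-((A t)ᵀ * P t) - P t * A t - Q) t := hPd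
  replace hSymm : ∀ t, (P t)ᵀ = P t := hSymm
  replace hP : ∀ t, P t = (Ψ t)ᵀ * J t * Ψ t := hP
  replace hJd : ∀ t, HasDerivAt J (-((Φ t)ᵀ * Q * Φ t)) t := hJd
  have hQuad : ∀ (w : Fin n → ℝ) t, w ≠ 0 → 0 < w ⬝ᵥ J t *ᵥ w := by
    intro w t hw
    have hd : ∀ t, HasDerivAt (fun s => lyapQuad w (J s)) (lyapQuad w (-((Φ t)ᵀ * Q * Φ t))) t := fun t =>
      ((lyapQuad w).hasFDerivAt (x := J t)).comp_hasDerivAt t (hJd t)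
    have hanti : StrictAnti (fun s => lyapQuad w (J s)) := by
      refine strictAnti_of_deriv_neg fun t => ?_
      rw [(hd t).deriv, map_neg, lyapQuad_apply, neg_lt_zero, lyap_quad_conj]
      have hne : Φ t *ᵥ w ≠ 0 := by
        intro h0
        apply hw
        rw [← Matrix.one_mulVec w, ← hΨΦ t, ← Matrix.mulVec_mulVec, h0, Matrix.mulVec_zero]
      simpa using hQpos.dotProduct_mulVec_pos hne
    have hl : Filter.Tendsto (fun s => lyapQuad w (J s)) Filter.atTop (nhds 0) := by
      have := ((lyapQuad w).continuous.tendsto 0).comp hJlim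
      rw [map_zero] at this
      exact this
    have h1 : 0 ≤ lyapQuad w (J (t + 1)) := hanti.antitone.le_of_tendsto hl (t + 1)
    exact lt_of_le_of_lt h1 (hanti (by linarith : t < t + 1))
  refine ⟨P, ⟨fun t i j => ((lyap_hasDerivAt_iff _ _ _).1 (hPd t) i j).differentiableAt, ?_, hPer⟩,
    ?_, ?_⟩
  · intro t
    have : Matrix.of (fun i j => deriv (fun s => P s i j) t)
        = -((A t)ᵀ * P t) - P t * A t - Q := by
      ext i j
      exact ((lyap_hasDerivAt_iff _ _ _).1 (hPd t) i j).deriv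
    rw [this]
    noncomm_ring
  · intro t
    refine ⟨hSymm t, Matrix.PosDef.of_dotProduct_mulVec_pos ?_ ?_⟩
    · rw [Matrix.IsHermitian, Matrix.conjTranspose_eq_transpose_of_trivial]
      exact hSymm t
    · intro v hv
      rw [star_trivial, hP, lyap_quad_conj]
      refine hQuad _ t fun h0 => hv ?_
      rw [← Matrix.one_mulVec v, ← hΦΨ t, ← Matrix.mulVec_mulVec, h0, Matrix.mulVec_zero]
  · rintro P₂ ⟨hdiff, hode, hper⟩
    have hd2 : ∀ t, HasDerivAt P₂ (-((A t)ᵀ * P₂ t) - P₂ t * A t - Q) t := by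
      intro t
      have e : -((A t)ᵀ * P₂ t) - P₂ t * A t - Q
          = Matrix.of (fun i j => deriv (fun s => P₂ s i j) t) := by
        rw [← sub_eq_zero, ← neg_eq_zero, ← hode t]
        noncomm_ring
      rw [e, lyap_hasDerivAt_iff]
      intro i j
      exact (hdiff t i j).hasDerivAt
    exact huniq P₂ hd2 hper

end

/-- For an exponentially stable `T`-periodic linear system `ẋ = A(t)x` and any
symmetric positive definite `Q`, the Lyapunov differential equation
`P' + AᵀP + PA + Q = 0` has a unique differentiable `T`-periodic solution,
which is moreover symmetric and positive definite for every `t`. -/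
theorem periodic_lyapunov_equation
    {n : ℕ} (T : ℝ) (hT : 0 < T)
    (A : ℝ → Matrix (Fin n) (Fin n) ℝ)
    (hAcont : Continuous A) (hAper : ∀ t : ℝ, A (t + T) = A t)
    (c lam : ℝ) (hc : 0 < c) (hlam : 0 < lam)
    (hstab : ∀ x : ℝ → (Fin n → ℝ), Differentiable ℝ x →
      (∀ t : ℝ, deriv x t = (A t).mulVec (x t)) →
      ∀ s t : ℝ, s ≤ t → ‖x t‖ ≤ c * Real.exp (-lam * (t - s)) * ‖x s‖)
    (Q : Matrix (Fin n) (Fin n) ℝ) (hQsymm : Q.IsSymm) (hQpos : Q.PosDef) :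
    ∃ P : ℝ → Matrix (Fin n) (Fin n) ℝ,
      ((∀ (t : ℝ) (i j : Fin n), DifferentiableAt ℝ (fun s => P s i j) t) ∧
        (∀ t : ℝ, Matrix.of (fun i j => deriv (fun s => P s i j) t)
          + (A t)ᵀ * P t + P t * A t + Q = 0) ∧
        (∀ t : ℝ, P (t + T) = P t)) ∧
      (∀ t : ℝ, (P t).IsSymm ∧ (P t).PosDef) ∧
      (∀ P₂ : ℝ → Matrix (Fin n) (Fin n) ℝ,
        ((∀ (t : ℝ) (i j : Fin n), DifferentiableAt ℝ (fun s => P₂ s i j) t) ∧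
          (∀ t : ℝ, Matrix.of (fun i j => deriv (fun s => P₂ s i j) t)
            + (A t)ᵀ * P₂ t + P₂ t * A t + Q = 0) ∧
          (∀ t : ℝ, P₂ (t + T) = P₂ t)) → P₂ = P) := by
  exact lyap_core T hT A hAcont hAper c lam hc hlam hstab Q hQsymm hQpos
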